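/- Let R' = ℂ[x,u,v,w], let τ, λ ∈ ℂ, and let f₀ = 1 + u³ + v³ + τ·u·v ∈ R'. Setting η' := λ·ι(d(x³·f₀)) ∧ ι(dw) − x³·ι(du) ∧ ι(dv) in the exterior algebra Λ(Ω_{R'/ℂ}), one has η' ∧ η' = −6λ·x⁵·f₀ · ι(dx) ∧ ι(du) ∧ ι(dv) ∧ ι(dw). -/

import Mathlib

/-!
STATEMENT 6: In `R' = ℂ[x,u,v,w]`, for `τ, λ ∈ ℂ` and `f₀ = 1 + u³ + v³ + τuv`, setting
`η' := λ·ι(d(x³f₀))∧ι(dw) − x³·ι(du)∧ι(dv)` in the exterior algebra of `Ω_{R'/ℂ}`, one has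
`η' ∧ η' = −6λ·x⁵·f₀ · ι(dx)∧ι(du)∧ι(dv)∧ι(dw)`.
-/

noncomputable section

open MvPolynomial

/-- The polynomial ring `R' = ℂ[x,u,v,w]`. -/
abbrev R' : Type := MvPolynomial (Fin 4) ℂ

/-- The universal derivation `d : R' → Ω_{R'/ℂ}`. -/
def d : R' → Ω[R'⁄ℂ] := KaehlerDifferential.D ℂ R'

/-- The canonical linear map `ι : Ω_{R'/ℂ} → Λ(Ω_{R'/ℂ})`. -/
def ι : Ω[R'⁄ℂ] →ₗ[R'] ExteriorAlgebra R' (Ω[R'⁄ℂ]) := ExteriorAlgebra.ι R'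

/-- The variable `x`. -/
def x : R' := MvPolynomial.X 0
/-- The variable `u`. -/
def u : R' := MvPolynomial.X 1
/-- The variable `v`. -/
def v : R' := MvPolynomial.X 2
/-- The variable `w`. -/
def w : R' := MvPolynomial.X 3

namespace ExteriorAlgebra

variable {R M : Type*} [CommRing R] [AddCommGroup M] [Module R M]

theorem ι_mul_ι_swap (a b : M) :
    ExteriorAlgebra.ι R a * ExteriorAlgebra.ι R b =
      -(ExteriorAlgebra.ι R b * ExteriorAlgebra.ι R a) :=
  eq_neg_of_add_eq_zero_left (ι_add_mul_swap a b)

theorem ι_mul_ι_mul_ι_comm (a b c : M) :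
    ExteriorAlgebra.ι R a * (ExteriorAlgebra.ι R b * ExteriorAlgebra.ι R c) =
      ExteriorAlgebra.ι R b * ExteriorAlgebra.ι R c * ExteriorAlgebra.ι R a := by
  rw [← mul_assoc, ι_mul_ι_swap a b, neg_mul, mul_assoc, ι_mul_ι_swap a c, mul_neg, neg_neg,
    mul_assoc]

theorem ι_mul_ι_mul_self (a b : M) :
    ExteriorAlgebra.ι R a * ExteriorAlgebra.ι R b *
      (ExteriorAlgebra.ι R a * ExteriorAlgebra.ι R b) = 0 := by
  rw [← mul_assoc, mul_assoc (ExteriorAlgebra.ι R a), ι_mul_ι_swap b a, mul_neg, ← mul_assoc,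
    ι_sq_zero, zero_mul, neg_zero, zero_mul]

/-- The square of a difference of two decomposable bivectors. -/
theorem sub_smul_ι_mul_ι_mul_self (r s : R) (a b c e : M) :
    (r • (ExteriorAlgebra.ι R a * ExteriorAlgebra.ι R b) -
        s • (ExteriorAlgebra.ι R c * ExteriorAlgebra.ι R e)) *
      (r • (ExteriorAlgebra.ι R a * ExteriorAlgebra.ι R b) -
        s • (ExteriorAlgebra.ι R c * ExteriorAlgebra.ι R e)) =
      (-(2 * r * s)) • (ExteriorAlgebra.ι R a * ExteriorAlgebra.ι R c *
        ExteriorAlgebra.ι R e * ExteriorAlgebra.ι R b) := by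
  have h₁ : ExteriorAlgebra.ι R a * ExteriorAlgebra.ι R b *
      (ExteriorAlgebra.ι R c * ExteriorAlgebra.ι R e) =
      ExteriorAlgebra.ι R a * ExteriorAlgebra.ι R c *
        ExteriorAlgebra.ι R e * ExteriorAlgebra.ι R b := by
    rw [mul_assoc, ι_mul_ι_mul_ι_comm b c e]
    simp only [mul_assoc]
  have h₂ : ExteriorAlgebra.ι R c * ExteriorAlgebra.ι R e *
      (ExteriorAlgebra.ι R a * ExteriorAlgebra.ι R b) =
      ExteriorAlgebra.ι R a * ExteriorAlgebra.ι R c *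
        ExteriorAlgebra.ι R e * ExteriorAlgebra.ι R b := by
    rw [← mul_assoc, ← ι_mul_ι_mul_ι_comm a c e]
    simp only [mul_assoc]
  simp only [mul_sub, sub_mul, smul_mul_smul_comm, ι_mul_ι_mul_self, h₁, h₂, smul_zero]
  module

/-- Modulo `c` and `e`, the first factor of a product ending in `c ∧ e` may be replaced. -/
theorem ι_smul_add_mul_ι_mul_ι (r s t : R) (a c e : M) :
    ExteriorAlgebra.ι R (r • a + s • c + t • e) * ExteriorAlgebra.ι R c *
      ExteriorAlgebra.ι R e =
      r • (ExteriorAlgebra.ι R a * ExteriorAlgebra.ι R c * ExteriorAlgebra.ι R e) := by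
  have h : ExteriorAlgebra.ι R e * ExteriorAlgebra.ι R c * ExteriorAlgebra.ι R e = 0 := by
    rw [ι_mul_ι_swap e c, neg_mul, mul_assoc, ι_sq_zero, mul_zero, neg_zero]
  simp only [map_add, map_smul, add_mul, smul_mul_assoc, ι_sq_zero, h, smul_zero,
    add_zero]

end ExteriorAlgebra

theorem d_cube_mul_chart_polynomial (τ : ℂ) :
    d (x ^ 3 * (1 + u ^ 3 + v ^ 3 + (C τ : R') * u * v)) =
      (3 * x ^ 2 * (1 + u ^ 3 + v ^ 3 + (C τ : R') * u * v)) • d x +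
        (x ^ 3 * (3 * u ^ 2 + C τ * v)) • d u + (x ^ 3 * (3 * v ^ 2 + C τ * u)) • d v := by
  have hC : KaehlerDifferential.D ℂ R' (C τ) = 0 :=
    (KaehlerDifferential.D ℂ R').map_algebraMap τ
  simp only [d, Derivation.leibniz, Derivation.leibniz_pow, map_add, Derivation.map_one_eq_zero,
    hC, ← Nat.cast_smul_eq_nsmul R']
  push_cast
  module

theorem statement6 (τ lam : ℂ) (f₀ : R')
    (hf₀ : f₀ = 1 + u ^ 3 + v ^ 3 + (C τ : R') * u * v)
    (η' : ExteriorAlgebra R' (Ω[R'⁄ℂ]))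
    (hη' : η' = (C lam : R') • (ι (d (x ^ 3 * f₀)) * ι (d w)) -
        (x ^ 3) • (ι (d u) * ι (d v))) :
    η' * η'
      = (-(6 * (C lam : R') * x ^ 5 * f₀)) • (ι (d x) * ι (d u) * ι (d v) * ι (d w)) := by
  subst hf₀ hη'
  have h := ExteriorAlgebra.sub_smul_ι_mul_ι_mul_self (C lam : R') (x ^ 3)
    (d (x ^ 3 * (1 + u ^ 3 + v ^ 3 + (C τ : R') * u * v))) (d w) (d u) (d v)
  rw [d_cube_mul_chart_polynomial, ExteriorAlgebra.ι_smul_add_mul_ι_mul_ι, smul_mul_assoc,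
    smul_smul, ← d_cube_mul_chart_polynomial] at h
  refine h.trans ?_
  rw [ι]
  congr 1
  ring
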